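/- Let (Δ, 𝒜, μ) be a probability space, M ≥ 1 an integer, and Θ a measurable space of decisions. For each m ∈ {1,…,M} let A_m : Δ^m → Θ be a measurable map, and assume A_M is invariant under permutations of its arguments. For a multisample S = (δ₁,…,δ_M) ∈ Δ^M, call an index set {i₁ < … < i_k} ⊆ {1,…,M} a support subsample if A_k(δ_{i₁},…,δ_{i_k}) = A_M(δ₁,…,δ_M). Let k* : Δ^M → {0,…,M} be a measurable map such that for every multisample S there exists a support subsample of S of cardinality k*(S). Let Viol ⊆ Θ × Δ be a measurable set, define the violation probability V(θ) = μ{δ ∈ Δ : (θ, δ) ∈ Viol}, and assume consistency: for every multisample S = (δ₁,…,δ_M), the decision θ = A_M(S) satisfies (θ, δ_j) ∉ Viol for every j ∈ {1,…,M}. Let β ∈ (0,1) and let ε : {0,…,M} → [0,1] satisfy ε(M) = 1 and ∑_{k=0}^{M−1} C(M,k)·(1 − ε(k))^{M−k} = β, where C(M,k) is the binomial coefficient. Then, under the product measure μ^M of M independent draws, the probability of the event { S ∈ Δ^M : V(A_M(S)) > ε(k*(S)) } is at most β. -/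

import Mathlib

open MeasureTheory
open scoped BigOperators ENNReal

theorem scenario_aux_fixed {Δ : Type*} [MeasurableSpace Δ] (μ : Measure Δ) [IsProbabilityMeasure μ]
    {Θ : Type*} [MeasurableSpace Θ] (M : ℕ) (s : Finset (Fin M))
    (g : ({i // i ∈ s} → Δ) → Θ) (hg : Measurable g)
    (Viol : Set (Θ × Δ)) (hViol : MeasurableSet Viol) (e : ℝ) (he0 : 0 ≤ e) :
    (Measure.pi fun _ : Fin M => μ)
      {S : Fin M → Δ | ENNReal.ofReal e < μ {δ : Δ | (g (fun i => S i), δ) ∈ Viol} ∧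
        ∀ j, (g (fun i => S i), S j) ∉ Viol} ≤ ENNReal.ofReal (1 - e) ^ (M - s.card) := by
  classical
  let T : Set (({i // i ∈ s} → Δ) × ({i // ¬ i ∈ s} → Δ)) :=
    {p | ENNReal.ofReal e < μ {δ : Δ | (g p.1, δ) ∈ Viol} ∧ ∀ j, (g p.1, p.2 j) ∉ Viol}
  have hT : MeasurableSet T := by
    have h1 : Measurable fun θ : Θ => μ {δ : Δ | (θ, δ) ∈ Viol} :=
      measurable_measure_prodMk_left hViol
    have h2 : MeasurableSet {p : ({i // i ∈ s} → Δ) × ({i // ¬ i ∈ s} → Δ) |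
        ENNReal.ofReal e < μ {δ : Δ | (g p.1, δ) ∈ Viol}} :=
      measurableSet_lt measurable_const (h1.comp (hg.comp measurable_fst))
    have h3 : MeasurableSet {p : ({i // i ∈ s} → Δ) × ({i // ¬ i ∈ s} → Δ) |
        ∀ j, (g p.1, p.2 j) ∉ Viol} := by
      rw [Set.ofPred_forall]
      refine MeasurableSet.iInter fun j => ?_
      have h4 : Measurable fun p : ({i // i ∈ s} → Δ) × ({i // ¬ i ∈ s} → Δ) =>
          (g p.1, p.2 j) :=
        (hg.comp measurable_fst).prodMk ((measurable_pi_apply j).comp measurable_snd)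
      exact h4 hViol.compl
    exact h2.inter h3
  have hmp := measurePreserving_piEquivPiSubtypeProd (fun _ : Fin M => μ) (fun i => i ∈ s)
  calc _ ≤ (Measure.pi fun _ : Fin M => μ)
        ((MeasurableEquiv.piEquivPiSubtypeProd (fun _ : Fin M => Δ) (fun i => i ∈ s)) ⁻¹' T) := by
        refine measure_mono fun S hS => ⟨hS.1, fun j => hS.2 j⟩
    _ = ((Measure.pi fun _ : {i // i ∈ s} => μ).prod (Measure.pi fun _ : {i // ¬ i ∈ s} => μ)) T :=
        by
          have h := hmp.measure_preimage hT.nullMeasurableSet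
          convert h
    _ = ∫⁻ x, (Measure.pi fun _ : {i // ¬ i ∈ s} => μ) (Prod.mk x ⁻¹' T)
          ∂(Measure.pi fun _ : {i // i ∈ s} => μ) := Measure.prod_apply hT
    _ ≤ ∫⁻ x, ENNReal.ofReal (1 - e) ^ (M - s.card)
          ∂(Measure.pi fun _ : {i // i ∈ s} => μ) := by
        refine lintegral_mono fun x => ?_
        by_cases hx : ENNReal.ofReal e < μ {δ : Δ | (g x, δ) ∈ Viol}
        · have hV : MeasurableSet {δ : Δ | (g x, δ) ∈ Viol} := measurable_prodMk_left hViol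
          have hsub : Prod.mk x ⁻¹' T ⊆
              Set.pi Set.univ (fun _ : {i // ¬ i ∈ s} => {δ : Δ | (g x, δ) ∈ Viol}ᶜ) :=
            fun y hy j _ => hy.2 j
          refine (measure_mono hsub).trans ?_
          rw [Measure.pi_pi, Finset.prod_const, prob_compl_eq_one_sub hV]
          have hc : (Finset.univ : Finset {i // ¬ i ∈ s}).card = M - s.card := by
            rw [Finset.card_univ, Fintype.card_subtype_compl]
            simp
          rw [hc]
          gcongr
          rw [ENNReal.ofReal_sub _ he0, ENNReal.ofReal_one]
          gcongr
        · have : Prod.mk x ⁻¹' T = ∅ := by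
            ext y
            simp only [Set.mem_preimage, Set.mem_empty_iff_false, iff_false]
            exact fun hy => hx hy.1
          rw [this]
          simp
    _ = _ := by simp

/-- General scenario-approach guarantee (Theorem 3 of the paper, after Campi,
Garatti and Ramponi 2018). Given a probability measure `μ` on the sample space
`Δ`, a family of measurable decision maps `A m : Δ^m → Θ` (for `m ≤ M`) whose
`M`-th member is permutation invariant, a measurable support-subsample size map
`k*` such that every multisample `S` admits a support subsample of cardinality
`k* S` (i.e. a subset of indices, taken in increasing order, on which the
decision map reproduces the full decision), and a measurable violation set that
is never hit by the decision on any of its own training samples, the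
probability (under `M` i.i.d. draws) that the violation probability of the
returned decision exceeds `ε (k* S)` is at most `β`, whenever
`ε : {0,…,M} → [0,1]` satisfies `ε M = 1` and
`∑_{k=0}^{M−1} C(M,k)·(1 − ε k)^(M−k) = β`. -/
theorem scenario_approach_guarantee
    {Δ : Type*} [MeasurableSpace Δ] (μ : Measure Δ) [IsProbabilityMeasure μ]
    {Θ : Type*} [MeasurableSpace Θ]
    (M : ℕ) (hM : 1 ≤ M)
    (A : (m : ℕ) → (Fin m → Δ) → Θ)
    (hAmeas : ∀ m ≤ M, Measurable (A m))
    (hperm : ∀ (σ : Equiv.Perm (Fin M)) (S : Fin M → Δ), A M (S ∘ σ) = A M S)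
    (kstar : (Fin M → Δ) → ℕ)
    (hkmeas : Measurable kstar)
    (hkle : ∀ S, kstar S ≤ M)
    (hsupport : ∀ S : Fin M → Δ, ∃ (s : Finset (Fin M)) (hcard : s.card = kstar S),
      A (kstar S) (fun j : Fin (kstar S) => S ((s.orderIsoOfFin hcard j : Fin M))) = A M S)
    (Viol : Set (Θ × Δ)) (hViol : MeasurableSet Viol)
    (hconsistent : ∀ (S : Fin M → Δ) (j : Fin M), (A M S, S j) ∉ Viol)
    (β : ℝ) (hβ : β ∈ Set.Ioo (0 : ℝ) 1)
    (ε : ℕ → ℝ) (hε01 : ∀ k ≤ M, ε k ∈ Set.Icc (0 : ℝ) 1) (hεM : ε M = 1)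
    (hεβ : ∑ k ∈ Finset.range M, (M.choose k : ℝ) * (1 - ε k) ^ (M - k) = β) :
    (Measure.pi fun _ : Fin M => μ)
        {S : Fin M → Δ |
          ENNReal.ofReal (ε (kstar S)) < μ {δ : Δ | (A M S, δ) ∈ Viol}}
      ≤ ENNReal.ofReal β := by
  classical
  let G : (s : Finset (Fin M)) → ({i // i ∈ s} → Δ) → Θ := fun s x =>
    A s.card (fun j => x (s.orderIsoOfFin rfl j))
  let B : Finset (Fin M) → Set (Fin M → Δ) := fun s =>
    {S | ENNReal.ofReal (ε s.card) < μ {δ : Δ | (G s (fun i => S i), δ) ∈ Viol} ∧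
        ∀ j, (G s (fun i => S i), S j) ∉ Viol}
  have hcardle : ∀ s : Finset (Fin M), s.card ≤ M := fun s => by
    simpa using s.card_le_univ
  have hB : ∀ s, (Measure.pi fun _ : Fin M => μ) (B s)
      ≤ ENNReal.ofReal (1 - ε s.card) ^ (M - s.card) := fun s => by
    refine scenario_aux_fixed μ M s (G s) ?_ Viol hViol (ε s.card) (hε01 _ (hcardle s)).1
    exact (hAmeas _ (hcardle s)).comp (measurable_pi_lambda _ fun j => measurable_pi_apply _)
  have hsub : {S : Fin M → Δ |
          ENNReal.ofReal (ε (kstar S)) < μ {δ : Δ | (A M S, δ) ∈ Viol}} ⊆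
      ⋃ k ∈ Finset.range M, ⋃ s ∈ Finset.powersetCard k (Finset.univ : Finset (Fin M)), B s := by
    intro S hS
    simp only [Set.mem_ofPred_eq] at hS
    obtain ⟨s, hcard, hA⟩ := hsupport S
    have hlt : kstar S < M := by
      refine lt_of_le_of_ne (hkle S) fun h => ?_
      rw [h, hεM, ENNReal.ofReal_one] at hS
      exact absurd hS (not_lt.mpr prob_le_one)
    have hG : G s (fun i => S i) = A M S := by
      rw [← hA]
      generalize kstar S = k at hcard
      subst hcard
      rfl
    simp only [Set.mem_iUnion]
    refine ⟨kstar S, Finset.mem_range.mpr hlt, s, by simp [Finset.mem_powersetCard, hcard], ?_⟩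
    simp only [B, Set.mem_ofPred_eq]
    rw [hG, hcard]
    exact ⟨hS, hconsistent S⟩
  refine (measure_mono hsub).trans ?_
  refine (measure_biUnion_finset_le _ _).trans ?_
  rw [← hεβ, ENNReal.ofReal_sum_of_nonneg]
  · refine Finset.sum_le_sum fun k hk => ?_
    refine (measure_biUnion_finset_le _ _).trans ?_
    have hk1 : 0 ≤ 1 - ε k := by
      linarith [(hε01 k (Finset.mem_range.mp hk).le).2]
    calc _ ≤ ∑ s ∈ Finset.powersetCard k (Finset.univ : Finset (Fin M)),
          ENNReal.ofReal (1 - ε k) ^ (M - k) := by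
          refine Finset.sum_le_sum fun s hs => ?_
          have := hB s
          rwa [(Finset.mem_powersetCard.mp hs).2] at this
      _ = _ := by
          rw [Finset.sum_const, Finset.card_powersetCard, Finset.card_univ, Fintype.card_fin,
            nsmul_eq_mul, ENNReal.ofReal_mul (by positivity), ENNReal.ofReal_natCast,
            ENNReal.ofReal_pow hk1]
  · intro k hk
    have hk1 : 0 ≤ 1 - ε k := by
      linarith [(hε01 k (Finset.mem_range.mp hk).le).2]
    positivity
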